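/- arXiv:2009.13768 — 6 statements merged into one kernel-verified Lean document; each statement's English description precedes it below -/
import Mathlib

section
/- If a Two-Stacks state satisfies the Two-Stacks invariants and its window contents are v₀,…,v_{n−1}, then query() = aggF ⊗ aggB equals the ordered product v₀ ⊗ … ⊗ v_{n−1}; in particular query() = 1 when the window is empty. -/
/-!
STATEMENT 1: If a Two-Stacks state satisfies the Two-Stacks invariants and its
window contents are `v₀,…,v_{n−1}`, then `query() = aggF ⊗ aggB` equals the
ordered product `v₀ ⊗ … ⊗ v_{n−1}`; in particular `query() = 1` when the
window is empty.
-/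

namespace TwoStacks

variable {M : Type*} [Monoid M]

/-- The Two-Stacks invariants for front stack `F`, back stack `B` and window
contents `vals`: the `val` fields of `F` followed by those of `B` are exactly
`vals`; for `0 ≤ i < |F|`, `F[i].agg = v_i ⊗ … ⊗ v_{|F|−1}`; and for
`0 ≤ j < |B|`, `B[j].agg = v_{|F|} ⊗ … ⊗ v_{|F|+j}`. -/
def Inv (F B : List (M × M)) (vals : List M) : Prop :=
  F.map Prod.fst ++ B.map Prod.fst = vals ∧
  (∀ i (hi : i < F.length), (F[i]'hi).2 = ((vals.take F.length).drop i).prod) ∧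
  (∀ j (hj : j < B.length),
    (B[j]'hj).2 = ((vals.take (F.length + j + 1)).drop F.length).prod)

/-- `aggF = F[0].agg` if `F` is nonempty (top of `F` is at index 0), `1` otherwise. -/
def aggF (F : List (M × M)) : M :=
  match F with
  | [] => 1
  | x :: _ => x.2

/-- `aggB = B[|B|−1].agg` if `B` is nonempty (top of `B` is its last element), `1` otherwise. -/
def aggB (B : List (M × M)) : M :=
  match B.getLast? with
  | none => 1
  | some x => x.2

theorem query_correct (F B : List (M × M)) (vals : List M) (h : Inv F B vals) :
    aggF F * aggB B = vals.prod ∧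
    (vals = [] → aggF F * aggB B = 1) := by
  have key : aggF F * aggB B = vals.prod := by
    obtain ⟨h1, h2, h3⟩ := h
    have hF : aggF F = (vals.take F.length).prod := by
      cases F with
      | nil => simp [aggF]
      | cons x t =>
        have := h2 0 (by simp)
        simpa [aggF] using this
    have hB : aggB B = (vals.drop F.length).prod := by
      have hl : vals.length = F.length + B.length := by
        rw [← h1]; simp
      rcases List.eq_nil_or_concat B with hb | ⟨l, x, hb⟩
      · subst hb
        have : vals.drop F.length = [] := by
          apply List.drop_eq_nil_of_le
          rw [hl]; simp
        rw [this]; simp [aggB]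
      · have hb' : B.length = l.length + 1 := by rw [hb]; simp
        have := h3 l.length (by omega)
        rw [List.take_of_length_le (by omega)] at this
        rw [← this]
        subst hb
        simp [aggB]
    rw [hF, hB, List.prod_take_mul_prod_drop]
  exact ⟨key, fun hv => by rw [key, hv, List.prod_nil]⟩

end TwoStacks
end

section
/- If a Two-Stacks state with window contents v₀,…,v_{n−1} satisfies the Two-Stacks invariants, then the state obtained by insert(v) satisfies the Two-Stacks invariants for the window contents v₀,…,v_{n−1}, v. -/
/-!
STATEMENT 2: If a Two-Stacks state with window contents `v₀,…,v_{n−1}`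
satisfies the Two-Stacks invariants, then the state obtained by `insert(v)`
(which appends `(v, aggB ⊗ v)` to the back of `B`) satisfies the Two-Stacks
invariants for the window contents `v₀,…,v_{n−1}, v`.
-/

namespace TwoStacks

variable {M : Type*} [Monoid M]

theorem insert_preserves (F B : List (M × M)) (vals : List M) (v : M)
    (h : Inv F B vals) :
    Inv F (B ++ [(v, aggB B * v)]) (vals ++ [v]) := by
  obtain ⟨h1, h2, h3⟩ := h
  subst h1
  have agg : aggB B = (B.map Prod.fst).prod := by
    rcases List.eq_nil_or_concat B with rfl | ⟨L, x, rfl⟩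
    · simp [aggB]
    · have := h3 L.length (by simp)
      simp only [List.concat_eq_append] at this ⊢
      simp only [aggB, List.getLast?_append, List.getLast?_singleton, Option.some_or]
      rw [List.getElem_concat_length rfl] at this
      rw [this, List.take_of_length_le (by simp; try omega), List.drop_left' (by simp)]
  refine ⟨by simp, ?_, ?_⟩
  · intro i hi
    rw [h2 i hi, List.take_append_of_le_length (l₁ := F.map Prod.fst ++ B.map Prod.fst) (l₂ := [v]) (by simp)]
  · intro j hj
    by_cases hjB : j < B.length
    · rw [List.getElem_append_left hjB, h3 j hjB,
        List.take_append_of_le_length (l₁ := F.map Prod.fst ++ B.map Prod.fst) (l₂ := [v]) (by simp; omega)]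
    · have hj' : j = B.length := by simp at hj; omega
      subst hj'
      rw [List.getElem_concat_length rfl, List.take_of_length_le (by simp; try omega),
        List.append_assoc, List.drop_left' (by simp)]
      simp [agg]

end TwoStacks
end

section
/- If a Two-Stacks state with nonempty window contents v₀,…,v_{n−1} satisfies the Two-Stacks invariants, then the state obtained by evict() satisfies the Two-Stacks invariants for the window contents v₁,…,v_{n−1}. In particular, the flip performed when F is empty produces a front list F whose i-th entry has val = v_i and agg = v_i ⊗ … ⊗ v_{n−1} for all 0 ≤ i < n. -/
/-!
STATEMENT 3: If a Two-Stacks state with nonempty window contents `v₀,…,v_{n−1}`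
satisfies the Two-Stacks invariants, then the state obtained by `evict()`
satisfies the Two-Stacks invariants for the window contents `v₁,…,v_{n−1}`.
In particular, the flip performed when `F` is empty produces a front list `F`
whose `i`-th entry has `val = v_i` and `agg = v_i ⊗ … ⊗ v_{n−1}` for all
`0 ≤ i < n`.
-/

namespace TwoStacks

variable {M : Type*} [Monoid M]

/-- The flip loop: while `B` is nonempty, push `(B.top().val, B.top().val ⊗ aggF)`
onto `F` and pop `B`.  The second argument enumerates the elements of `B` from
its top (last index) to its bottom, i.e., it is `B.reverse`. -/
def flipAux (F : List (M × M)) : List (M × M) → List (M × M)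
  | [] => F
  | b :: rest => flipAux ((b.1, b.1 * aggF F) :: F) rest

/-- `evict()`: if `F` is empty, first flip (transferring all of `B` onto `F`),
then pop the top (index 0) of `F`. -/
def evictOp (F B : List (M × M)) : List (M × M) × List (M × M) :=
  match F with
  | [] => ((flipAux [] B.reverse).tail, ([] : List (M × M)))
  | _ :: F' => (F', B)

theorem flipAux_good (L : List (M × M)) : ∀ F : List (M × M),
    (∀ i (hi : i < F.length), (F[i]'hi).2 = ((F.map Prod.fst).drop i).prod) →
    (flipAux F L).map Prod.fst = (L.map Prod.fst).reverse ++ F.map Prod.fst ∧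
    (∀ i (hi : i < (flipAux F L).length),
      ((flipAux F L)[i]'hi).2 = (((flipAux F L).map Prod.fst).drop i).prod) := by
  induction L with
  | nil => intro F hF; exact ⟨by simp [flipAux], hF⟩
  | cons b rest ih =>
    intro F hF
    have hagg : aggF F = (F.map Prod.fst).prod := by
      cases F with
      | nil => simp [aggF]
      | cons x F' => exact hF 0 (by simp)
    have := ih ((b.1, b.1 * aggF F) :: F) (by
      intro i hi
      cases i with
      | zero => simp [hagg]
      | succ i => simpa using hF i (by simpa using hi))
    refine ⟨?_, this.2⟩
    rw [flipAux, this.1]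
    simp

theorem evict_preserves (F B : List (M × M)) (vals : List M)
    (h : Inv F B vals) (hne : vals ≠ []) :
    Inv (evictOp F B).1 (evictOp F B).2 vals.tail ∧
    (F = [] →
      (flipAux ([] : List (M × M)) B.reverse).map Prod.fst = vals ∧
      ∀ i (hi : i < (flipAux ([] : List (M × M)) B.reverse).length),
        ((flipAux ([] : List (M × M)) B.reverse)[i]'hi).2 = (vals.drop i).prod) := by
  obtain ⟨h1, h2, h3⟩ := h
  cases F with
  | nil =>
    obtain ⟨g1, g2⟩ := flipAux_good B.reverse ([] : List (M × M)) (by simp)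
    have g3 : (flipAux ([] : List (M × M)) B.reverse).map Prod.fst = vals := by
      rw [g1, ← h1]; simp
    rw [g3] at g2
    refine ⟨?_, fun _ => ⟨g3, g2⟩⟩
    simp only [evictOp]
    generalize flipAux ([] : List (M × M)) B.reverse = G at g2 g3
    subst g3
    cases G with
    | nil => simp at hne
    | cons x G =>
      refine ⟨by simp, ?_, by simp⟩
      intro i hi
      have := g2 (i+1) (by simpa using hi)
      have e : (G.map Prod.fst).take G.length = G.map Prod.fst :=
        List.take_of_length_le (by simp)
      simpa [e] using this
  | cons x F' =>
    refine ⟨?_, by simp⟩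
    subst h1
    refine ⟨by simp [evictOp], ?_, ?_⟩
    · intro i hi
      have := h2 (i+1) (by simpa [evictOp] using hi)
      simpa [evictOp] using this
    · intro j hj
      have := h3 j hj
      have e : (x :: F').length + j + 1 = (F'.length + j + 1) + 1 := by
        simp only [List.length_cons]; omega
      rw [e] at this
      simp only [List.map_cons, List.cons_append,
        List.take_succ_cons, List.length_cons, List.drop_succ_cons] at this
      exact this

end TwoStacks
end

section
/- If a Two-Stacks Lite state with window contents v₀,…,v_{n−1} satisfies the Two-Stacks Lite invariants, then: (a) the state obtained by insert(v) satisfies the invariants for the window contents v₀,…,v_{n−1}, v; and (b) if the window is nonempty, the state obtained by evict() satisfies the invariants for the window contents v₁,…,v_{n−1}. -/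
/-!
STATEMENT 6: If a Two-Stacks Lite state with window contents `v₀,…,v_{n−1}`
satisfies the Two-Stacks Lite invariants, then: (a) the state obtained by
`insert(v)` satisfies the invariants for the window contents `v₀,…,v_{n−1}, v`;
and (b) if the window is nonempty, the state obtained by `evict()` satisfies
the invariants for the window contents `v₁,…,v_{n−1}`.
-/

namespace TwoStacksLite

variable {M : Type*} [Monoid M]

/-- The Two-Stacks Lite invariants for state `(deque, s, aggB)` with window
contents `vals`: `deque` has length `n = |vals|`, `s ≤ n`; for `0 ≤ i < s`,
`deque[i] = v_i ⊗ … ⊗ v_{s−1}`; for `s ≤ i < n`, `deque[i] = v_i`;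
and `aggB = v_s ⊗ … ⊗ v_{n−1}` (which is `1` when `s = n`). -/
def Inv (deque : List M) (s : ℕ) (aggB : M) (vals : List M) : Prop :=
  deque.length = vals.length ∧
  s ≤ vals.length ∧
  (∀ i, i < s → deque.getD i 1 = ((vals.take s).drop i).prod) ∧
  (∀ i, s ≤ i → i < vals.length → deque.getD i 1 = vals.getD i 1) ∧
  aggB = (vals.drop s).prod

/-- One flip-loop iteration: replace entry `i` by `(entry i) ⊗ (entry (i+1))`. -/
def upd (l : List M) (i : ℕ) : List M :=
  l.set i (l.getD i 1 * l.getD (i + 1) 1)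

/-- Perform the updates at indices `i, i−1, …, 0`, in that (descending) order. -/
def flipFrom (l : List M) : ℕ → List M
  | 0 => upd l 0
  | i + 1 => flipFrom (upd l (i + 1)) i

/-- The flip loop, for `I = n−2` down to `0` (no iterations when `n ≤ 1`). -/
def flipAll (l : List M) : List M :=
  if l.length ≤ 1 then l else flipFrom l (l.length - 2)

/-- `evict()`: if `s = 0` (and the window is nonempty), first flip — rewrite
the deque into suffix products, set `s ← n` and `aggB ← 1` — then remove
`deque[0]`, decrementing `s` (clamped at 0) and `n` by one. -/
def evictOp (deque : List M) (s : ℕ) (aggB : M) : List M × ℕ × M :=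
  if s = 0 then ((flipAll deque).tail, deque.length - 1, 1)
  else (deque.tail, s - 1, aggB)

theorem drop_prod_eq (vals : List M) (i : ℕ) (h : i < vals.length) :
    (vals.drop i).prod = vals.getD i 1 * (vals.drop (i + 1)).prod := by
  rw [List.drop_eq_getElem_cons h, List.prod_cons, List.getD_eq_getElem _ _ h]

theorem getD_upd (l : List M) (i j : ℕ) (h : i < l.length) :
    (upd l i).getD j 1 = if i = j then l.getD i 1 * l.getD (i + 1) 1 else l.getD j 1 := by
  unfold upd
  simp only [List.getD_eq_getElem?_getD, List.getElem?_set]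
  split_ifs <;> simp

theorem length_upd (l : List M) (i : ℕ) : (upd l i).length = l.length := by
  simp [upd]

theorem upd_step (vals l : List M) (i : ℕ) (hl : l.length = vals.length)
    (hi : i + 1 < vals.length)
    (h1 : ∀ j, i < j → j < vals.length → l.getD j 1 = (vals.drop j).prod)
    (h2 : ∀ j, j ≤ i → l.getD j 1 = vals.getD j 1) :
    ∀ j, i ≤ j → j < vals.length → (upd l i).getD j 1 = (vals.drop j).prod := by
  intro j hj hjn
  rw [getD_upd l i j (by omega)]
  split_ifs with hij
  · subst hij
    rw [drop_prod_eq vals i hjn, h2 i le_rfl, h1 (i + 1) (by omega) hi]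
  · exact h1 j (by omega) hjn

theorem flipFrom_spec (vals : List M) (i : ℕ) : ∀ (l : List M), l.length = vals.length →
    i + 1 < vals.length →
    (∀ j, i < j → j < vals.length → l.getD j 1 = (vals.drop j).prod) →
    (∀ j, j ≤ i → l.getD j 1 = vals.getD j 1) →
    (flipFrom l i).length = vals.length ∧
    ∀ j, j < vals.length → (flipFrom l i).getD j 1 = (vals.drop j).prod := by
  induction i with
  | zero =>
    intro l hl hi h1 h2
    refine ⟨by simp [flipFrom, length_upd, hl], fun j hj => ?_⟩
    exact upd_step vals l 0 hl hi h1 h2 j (by omega) hj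
  | succ i ih =>
    intro l hl hi h1 h2
    refine ih (upd l (i + 1)) (by rw [length_upd, hl]) (by omega) ?_ ?_
    · intro j hj hjn
      exact upd_step vals l (i + 1) hl hi h1 h2 j (by omega) hjn
    · intro j hj
      rw [getD_upd l _ j (by omega), if_neg (by omega)]
      exact h2 j (by omega)

theorem flipAll_spec (vals l : List M) (hl : l.length = vals.length)
    (h : ∀ j, j < vals.length → l.getD j 1 = vals.getD j 1) :
    (flipAll l).length = vals.length ∧
    ∀ j, j < vals.length → (flipAll l).getD j 1 = (vals.drop j).prod := by
  unfold flipAll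
  split_ifs with h1
  · refine ⟨hl, fun j hj => ?_⟩
    rw [drop_prod_eq vals j hj, List.drop_eq_nil_of_le (by omega), h j hj]
    simp
  · refine flipFrom_spec vals _ l hl (by omega) ?_ (fun j hj => h j (by omega))
    intro j hj hjn
    rw [drop_prod_eq vals j hjn, List.drop_eq_nil_of_le (by omega), h j hjn]
    simp

theorem getD_tail (l : List M) (i : ℕ) : l.tail.getD i 1 = l.getD (i + 1) 1 := by
  cases l <;> simp

theorem insert_evict_preserve (deque : List M) (s : ℕ) (aggB : M)
    (vals : List M) (h : Inv deque s aggB vals) :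
    (∀ v : M, Inv (deque ++ [v]) s (aggB * v) (vals ++ [v])) ∧
    (vals ≠ [] →
      Inv (evictOp deque s aggB).1 (evictOp deque s aggB).2.1
        (evictOp deque s aggB).2.2 vals.tail) := by
  obtain ⟨hl, hs, hF, hB, hA⟩ := h
  constructor
  · intro v
    refine ⟨by simp [hl], by simp; omega, ?_, ?_, ?_⟩
    · intro i hi
      rw [List.getD_append _ _ _ _ (by omega), hF i hi, List.take_append_of_le_length hs]
    · intro i hi hin
      simp only [List.length_append, List.length_singleton] at hin
      by_cases hc : i < vals.length
      · rw [List.getD_append _ _ _ _ (by omega), List.getD_append _ _ _ _ hc, hB i hi hc]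
      · rw [List.getD_append_right _ _ _ _ (by omega),
          List.getD_append_right _ _ _ _ (by omega), hl]
    · rw [List.drop_append_of_le_length hs, hA]
      simp
  · intro hne
    have hpos : 0 < vals.length := List.length_pos_iff.mpr hne
    unfold evictOp
    split_ifs with h0
    · subst h0
      obtain ⟨f1, f2⟩ := flipAll_spec vals deque hl (fun j hj => hB j (by omega) hj)
      refine ⟨by simp [f1], by simp [hl], ?_, ?_, ?_⟩
      · intro i hi
        dsimp only at hi ⊢
        rw [getD_tail, f2 _ (by omega), List.take_of_length_le (by simp [hl])]
        simp
      · intro i hi hin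
        simp only [List.length_tail] at hin
        dsimp only at hi
        omega
      · dsimp only
        rw [List.drop_eq_nil_of_le (by simp [hl])]
        simp
    · obtain ⟨t, rfl⟩ : ∃ t, s = t + 1 := ⟨s - 1, by omega⟩
      obtain ⟨x, xs, rfl⟩ := List.exists_cons_of_ne_nil hne
      simp only [List.length_cons] at hl hs hB
      refine ⟨by simp [hl], by simp; omega, ?_, ?_, ?_⟩
      · intro i hi
        simp only [Nat.add_sub_cancel] at hi
        have := hF (i + 1) (by omega)
        simpa [getD_tail] using this
      · intro i hi hin
        simp only [Nat.add_sub_cancel, List.tail_cons] at hi hin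
        have := hB (i + 1) (by omega) (by omega)
        simpa [getD_tail] using this
      · simpa using hA

end TwoStacksLite
end

section
/- Suppose a DABA state satisfies the DABA partial-aggregate invariants, B > 0, and L < R with R − L = A − R (so |l_L| = |l_R| > 0). Then the state obtained by the shrink step — setting deque[L].agg ← aggL ⊗ aggR ⊗ aggA, then L ← L + 1, then deque[A−1].agg ← deque[A−1].val ⊗ aggA, then A ← A − 1 — satisfies the DABA partial-aggregate invariants for the same window contents, with |l_L| and |l_R| each decreased by one. -/
/-!
STATEMENT 10: Suppose a DABA state satisfies the DABA partial-aggregate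
invariants, `B > 0`, and `L < R` with `R − L = A − R` (so `|l_L| = |l_R| > 0`).
Then the state obtained by the shrink step — setting
`deque[L].agg ← aggL ⊗ aggR ⊗ aggA`, then `L ← L + 1`, then
`deque[A−1].agg ← deque[A−1].val ⊗ aggA`, then `A ← A − 1` — satisfies the
DABA partial-aggregate invariants for the same window contents, with `|l_L|`
and `|l_R|` each decreased by one.
-/

namespace Daba

variable {M : Type*} [Monoid M]

/-- The DABA partial-aggregate invariants for the deque `q` of `(val, agg)`
pairs with indices `L ≤ R ≤ A ≤ B ≤ n`, where the window contents are the
`val` fields `w = q.map Prod.fst`. -/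
def AggInv (q : List (M × M)) (L R A B : ℕ) : Prop :=
  (∀ i, i < L →
    (q.getD i (1, 1)).2 = (((q.map Prod.fst).take B).drop i).prod) ∧
  (∀ i, L ≤ i → i < R →
    (q.getD i (1, 1)).2 = (((q.map Prod.fst).take R).drop i).prod) ∧
  (∀ i, R ≤ i → i < A →
    (q.getD i (1, 1)).2 = (((q.map Prod.fst).take (i + 1)).drop R).prod) ∧
  (∀ i, A ≤ i → i < B →
    (q.getD i (1, 1)).2 = (((q.map Prod.fst).take B).drop i).prod) ∧
  (∀ i, B ≤ i → i < q.length →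
    (q.getD i (1, 1)).2 = (((q.map Prod.fst).take (i + 1)).drop B).prod)

/-- `aggL = deque[L].agg` if `L < R`, `1` otherwise. -/
def aggL (q : List (M × M)) (L R : ℕ) : M :=
  if L < R then (q.getD L (1, 1)).2 else 1

/-- `aggR = deque[A−1].agg` if `R < A`, `1` otherwise. -/
def aggR (q : List (M × M)) (R A : ℕ) : M :=
  if R < A then (q.getD (A - 1) (1, 1)).2 else 1

/-- `aggA = deque[A].agg` if `A < B`, `1` otherwise. -/
def aggA (q : List (M × M)) (A B : ℕ) : M :=
  if A < B then (q.getD A (1, 1)).2 else 1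

/-- Overwrite the `agg` field of `deque[i]`, keeping its `val` field. -/
def setAgg (q : List (M × M)) (i : ℕ) (x : M) : List (M × M) :=
  q.set i ((q.getD i (1, 1)).1, x)

/-- The shrink step: `deque[L].agg ← aggL ⊗ aggR ⊗ aggA`; `L ← L + 1`;
`deque[A−1].agg ← deque[A−1].val ⊗ aggA`; `A ← A − 1`. -/
def shrinkStep (q : List (M × M)) (L R A B : ℕ) : List (M × M) :=
  let q1 := setAgg q L (aggL q L R * aggR q R A * aggA q A B)
  setAgg q1 (A - 1) ((q1.getD (A - 1) (1, 1)).1 * aggA q1 A B)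

theorem map_setAgg (q : List (M × M)) (i : ℕ) (x : M) :
    (setAgg q i x).map Prod.fst = q.map Prod.fst := by
  unfold setAgg
  apply List.ext_getElem
  · simp
  · intro n h1 h2
    simp only [List.length_map, List.length_set] at h1 h2
    simp only [List.getElem_map, List.getElem_set]
    split_ifs with h
    · subst h
      simp [List.getD_eq_getElem, h2]
    · rfl

theorem length_setAgg (q : List (M × M)) (i : ℕ) (x : M) :
    (setAgg q i x).length = q.length := by
  simp [setAgg]

theorem setAgg_snd_self (q : List (M × M)) (i : ℕ) (x : M) (h : i < q.length) :
    ((setAgg q i x).getD i (1, 1)).2 = x := by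
  simp [setAgg, h]

theorem setAgg_ne (q : List (M × M)) (i j : ℕ) (x : M) (h : i ≠ j) :
    (setAgg q i x).getD j (1, 1) = q.getD j (1, 1) := by
  simp [setAgg, List.getD_eq_getElem?_getD, List.getElem?_set_ne h]

theorem seg_mul (w : List M) (i j k : ℕ) (hij : i ≤ j) (hjk : j ≤ k) :
    ((w.take j).drop i).prod * ((w.take k).drop j).prod = ((w.take k).drop i).prod := by
  rw [← List.prod_append]
  congr 1
  obtain ⟨a, rfl⟩ := Nat.exists_eq_add_of_le hij
  obtain ⟨b, rfl⟩ := Nat.exists_eq_add_of_le hjk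
  simp only [List.drop_take]
  rw [show i + a + b - i = a + b by omega, show i + a - i = a by omega,
    show i + a + b - (i + a) = b by omega, List.take_add, List.drop_drop]

theorem seg_one (q : List (M × M)) (i : ℕ) (h : i < q.length) :
    (((q.map Prod.fst).take (i + 1)).drop i).prod = (q.getD i (1, 1)).1 := by
  rw [List.drop_take, List.drop_eq_getElem_cons (by simpa using h)]
  simp [h]

theorem shrink_preserves (q : List (M × M)) (L R A B : ℕ)
    (hLR : L ≤ R) (hRA : R ≤ A) (hAB : A ≤ B) (hBn : B ≤ q.length)
    (hinv : AggInv q L R A B)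
    (hB : 0 < B) (hL : L < R) (heq : R - L = A - R) :
    (shrinkStep q L R A B).map Prod.fst = q.map Prod.fst ∧
    AggInv (shrinkStep q L R A B) (L + 1) R (A - 1) B ∧
    R - (L + 1) = (R - L) - 1 ∧
    (A - 1) - R = (A - R) - 1 := by
  obtain ⟨h1, h2, h3, h4, h5⟩ := hinv
  have hRA' : R < A := by omega
  have hA : aggA q A B = (((q.map Prod.fst).take B).drop A).prod := by
    unfold aggA
    split_ifs with h
    · exact h4 A le_rfl h
    · have : A = B := by omega
      subst this
      rw [List.drop_eq_nil_of_le (by simp), List.prod_nil]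
  have hLv : aggL q L R * aggR q R A * aggA q A B
      = (((q.map Prod.fst).take B).drop L).prod := by
    rw [hA, aggL, aggR, if_pos hL, if_pos hRA', h2 L le_rfl hL, h3 (A - 1) (by omega) (by omega),
      show A - 1 + 1 = A by omega, seg_mul _ _ _ _ hLR hRA, seg_mul _ _ _ _ (by omega) hAB]
  have hA1 : ∀ x, aggA (setAgg q L x) A B = aggA q A B := by
    intro x
    unfold aggA
    rw [setAgg_ne _ _ _ _ (by omega)]
  have hAv : (q.getD (A - 1) (1, 1)).1 * aggA q A B
      = (((q.map Prod.fst).take B).drop (A - 1)).prod := by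
    rw [hA, ← seg_one _ _ (by omega), show A - 1 + 1 = A by omega,
      seg_mul _ _ _ _ (by omega) hAB]
  have hs : shrinkStep q L R A B = setAgg (setAgg q L (((q.map Prod.fst).take B).drop L).prod)
      (A - 1) (((q.map Prod.fst).take B).drop (A - 1)).prod := by
    simp only [shrinkStep]
    rw [hA1, setAgg_ne _ _ _ _ (by omega), hAv, hLv]
  have hm : (shrinkStep q L R A B).map Prod.fst = q.map Prod.fst := by
    rw [hs, map_setAgg, map_setAgg]
  have gL : ((shrinkStep q L R A B).getD L (1, 1)).2
      = (((q.map Prod.fst).take B).drop L).prod := by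
    rw [hs, setAgg_ne _ _ _ _ (by omega), setAgg_snd_self _ _ _ (by omega)]
  have gA : ((shrinkStep q L R A B).getD (A - 1) (1, 1)).2
      = (((q.map Prod.fst).take B).drop (A - 1)).prod := by
    rw [hs, setAgg_snd_self _ _ _ (by rw [length_setAgg]; omega)]
  have gn : ∀ i, i ≠ L → i ≠ A - 1 →
      (shrinkStep q L R A B).getD i (1, 1) = q.getD i (1, 1) := by
    intro i a b
    rw [hs, setAgg_ne _ _ _ _ b.symm, setAgg_ne _ _ _ _ a.symm]
  have hlen : (shrinkStep q L R A B).length = q.length := by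
    rw [hs, length_setAgg, length_setAgg]
  refine ⟨hm, ?_, by omega, by omega⟩
  unfold AggInv
  rw [hm, hlen]
  refine ⟨?_, ?_, ?_, ?_, ?_⟩
  · intro i hi
    by_cases h : i = L
    · rw [h, gL]
    · rw [gn i h (by omega), h1 i (by omega)]
  · intro i hi hi'
    rw [gn i (by omega) (by omega), h2 i (by omega) hi']
  · intro i hi hi'
    rw [gn i (by omega) (by omega), h3 i hi (by omega)]
  · intro i hi hi'
    by_cases h : i = A - 1
    · rw [h, gA]
    · rw [gn i (by omega) h, h4 i (by omega) hi']
  · intro i hi hi'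
    rw [gn i (by omega) (by omega), h5 i hi hi']

end Daba
end

section
/- If a DABA Lite state with window contents v₀,…,v_{n−1} satisfies the DABA Lite contents invariants and the DABA Lite size invariants, then: (a) the state obtained by insert(v) satisfies both invariants for the window contents v₀,…,v_{n−1}, v; and (b) if n > 0, the state obtained by evict() satisfies both invariants for the window contents v₁,…,v_{n−1}. -/
/-!
STATEMENT 15: If a DABA Lite state with window contents `v₀,…,v_{n−1}`
satisfies the DABA Lite contents invariants and the DABA Lite size invariants,
then: (a) the state obtained by `insert(v)` satisfies both invariants for the
window contents `v₀,…,v_{n−1}, v`; and (b) if `n > 0`, the state obtained by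
`evict()` satisfies both invariants for the window contents `v₁,…,v_{n−1}`.
-/

namespace DabaLite

variable {M : Type*} [Monoid M]

/-- A DABA Lite state: a deque of partial aggregates, pointers
`L ≤ R ≤ A ≤ B ≤ n`, and two extra partial aggregates `aggRA` and `aggB`. -/
structure State (M : Type*) where
  q : List M
  L : ℕ
  R : ℕ
  A : ℕ
  B : ℕ
  aggRA : M
  aggB : M

/-- `aggL = deque[L]` if `L < R`, `1` otherwise. -/
def aggL (s : State M) : M := if s.L < s.R then s.q.getD s.L 1 else 1

/-- `aggA = deque[A]` if `A < B`, `1` otherwise. -/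
def aggA (s : State M) : M := if s.A < s.B then s.q.getD s.A 1 else 1

/-- `fixup()`: if `B = 0` (singleton case) set `L, R, A, B` all to `n`,
`aggRA ← 1`, `aggB ← 1`; otherwise, if `L = B` (flip) set `L ← 0, A ← n, B ← n`,
`aggRA ← aggB`, `aggB ← 1`; then if `L = R` (shift) increment each of `L, R, A`
by one; else (shrink) set `deque[L] ← aggL ⊗ aggRA`, `L ← L + 1`,
`deque[A−1] ← deque[A−1] ⊗ aggA`, `A ← A − 1`. -/
def fixup (s : State M) : State M :=
  let n := s.q.length
  if s.B = 0 then ⟨s.q, n, n, n, n, 1, 1⟩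
  else
    let s1 : State M :=
      if s.L = s.B then ⟨s.q, 0, s.R, n, n, s.aggB, 1⟩ else s
    if s1.L = s1.R then
      ⟨s1.q, s1.L + 1, s1.R + 1, s1.A + 1, s1.B, s1.aggRA, s1.aggB⟩
    else
      let s2 : State M :=
        ⟨s1.q.set s1.L (aggL s1 * s1.aggRA), s1.L + 1, s1.R, s1.A, s1.B,
          s1.aggRA, s1.aggB⟩
      ⟨s2.q.set (s2.A - 1) (s2.q.getD (s2.A - 1) 1 * aggA s2),
        s2.L, s2.R, s2.A - 1, s2.B, s2.aggRA, s2.aggB⟩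

/-- `insert(v)`: append `v` to the deque, set `aggB ← aggB ⊗ v`, then `fixup()`. -/
def insertOp (s : State M) (v : M) : State M :=
  fixup ⟨s.q ++ [v], s.L, s.R, s.A, s.B, s.aggRA, s.aggB * v⟩

/-- `evict()`: remove the front element `deque[0]` (each pointer decreases by
one), then `fixup()`. -/
def evictOp (s : State M) : State M :=
  fixup ⟨s.q.tail, s.L - 1, s.R - 1, s.A - 1, s.B - 1, s.aggRA, s.aggB⟩

/-- The DABA Lite contents invariants for window contents `vals`. -/
def ContentsInv (s : State M) (vals : List M) : Prop :=
  s.q.length = vals.length ∧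
  (∀ i, i < s.L → s.q.getD i 1 = ((vals.take s.B).drop i).prod) ∧
  (∀ i, s.L ≤ i → i < s.R → s.q.getD i 1 = ((vals.take s.R).drop i).prod) ∧
  (∀ i, s.R ≤ i → i < s.A → s.q.getD i 1 = vals.getD i 1) ∧
  (s.L = s.R ∨ s.aggRA = ((vals.take s.B).drop s.R).prod) ∧
  (∀ i, s.A ≤ i → i < s.B → s.q.getD i 1 = ((vals.take s.B).drop i).prod) ∧
  (∀ i, s.B ≤ i → i < s.q.length → s.q.getD i 1 = vals.getD i 1) ∧
  s.aggB = (vals.drop s.B).prod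

/-- The DABA Lite size invariants (same as DABA's), with exact subtraction:
`(|l_F| = 0 ∧ |l_B| = 0) ∨ (|l_L| + |l_R| + |l_A| + 1 = |l_F| − |l_B| ∧ |l_L| = |l_R|)`
where `|l_F| = B`, `|l_L| = R − L`, `|l_R| = A − R`, `|l_A| = B − A`,
`|l_B| = n − B`. -/
def SizeInv (s : State M) : Prop :=
  (s.B = 0 ∧ s.q.length = 0) ∨
  ((s.R - s.L) + (s.A - s.R) + (s.B - s.A) + 1 + (s.q.length - s.B) = s.B ∧
    s.R - s.L = s.A - s.R)

/-- The full DABA Lite invariant: pointer ordering plus contents and size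
invariants. -/
def Inv (s : State M) (vals : List M) : Prop :=
  s.L ≤ s.R ∧ s.R ≤ s.A ∧ s.A ≤ s.B ∧ s.B ≤ s.q.length ∧
  ContentsInv s vals ∧ SizeInv s

theorem seg_mul (vals : List M) (i j k : ℕ) (hij : i ≤ j) (hjk : j ≤ k) :
    ((vals.take j).drop i).prod * ((vals.take k).drop j).prod
      = ((vals.take k).drop i).prod := by
  rw [← List.prod_append]
  congr 1
  have h1 : (vals.take k).drop i
      = ((vals.take k).drop i).take (j - i) ++ ((vals.take k).drop i).drop (j - i) :=
    (List.take_append_drop _ _).symm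
  rw [h1, List.drop_drop, List.take_drop, List.take_take]
  have e1 : i + (j - i) = j := by omega
  have e2 : min j k = j := by omega
  rw [e1, e2]

theorem seg_one (vals : List M) (i : ℕ) :
    ((vals.take (i+1)).drop i).prod = vals.getD i 1 := by
  induction vals generalizing i with
  | nil => simp
  | cons a t ih =>
    cases i with
    | zero => simp
    | succ i => simpa using ih i

theorem getD_set' (l : List M) (k i : ℕ) (x : M) (hk : k < l.length) :
    (l.set k x).getD i 1 = if i = k then x else l.getD i 1 := by
  simp only [List.getD_eq_getElem?_getD, List.getElem?_set]
  by_cases h : k = i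
  · subst h; simp [hk]
  · simp [h, Ne.symm h]

theorem step_inv (q vals : List M) (L R A B : ℕ) (x y : M)
    (hLR : L ≤ R) (hRA : R ≤ A) (hAB : A ≤ B) (hB : B ≤ q.length) (hLB : L < B)
    (hc : ContentsInv ⟨q, L, R, A, B, x, y⟩ vals)
    (hs : L + B = q.length) (he : R - L = A - R) (h0 : B ≠ 0) :
    Inv (fixup ⟨q, L, R, A, B, x, y⟩) vals := by
  obtain ⟨c1, c2, c3, c4, c5, c6, c7, c8⟩ := hc
  dsimp only at c1 c2 c3 c4 c5 c6 c7 c8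
  have hne : L ≠ B := by omega
  by_cases hl : L = R
  · have hA : A = R := by omega
    subst hl; subst hA
    simp only [fixup, h0, hne, if_false, if_true, Inv, ContentsInv, SizeInv]
    refine ⟨le_rfl, le_rfl, hLB, hB, ⟨c1, ?_, ?_, ?_, Or.inl trivial, ?_, c7, c8⟩, Or.inr ?_⟩
    · intro i hi
      by_cases h : i < A
      · exact c2 i h
      · exact c6 i (by omega) (by omega)
    · intro i _ _; omega
    · intro i _ _; omega
    · intro i _ _; exact c6 i (by omega) (by omega)
    · refine ⟨?_, ?_⟩ <;> first | trivial | omega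
  · have c5 := c5.resolve_left hl
    have hLR' : L < R := by omega
    have hRA' : R < A := by omega
    simp only [fixup, h0, hne, hl, if_false, Inv, ContentsInv, SizeInv, aggL, aggA, hLR', if_true]
    have hq1 : L < q.length := by omega
    have hq2 : A - 1 < (q.set L (q.getD L 1 * x)).length := by rw [List.length_set]; omega
    have vL : q.getD L 1 * x = ((vals.take B).drop L).prod := by
      rw [c3 L le_rfl hLR', c5, seg_mul _ _ _ _ hLR (by omega)]
    have vA : (q.set L (q.getD L 1 * x)).getD (A-1) 1 *
        (if A < B then (q.set L (q.getD L 1 * x)).getD A 1 else 1)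
        = ((vals.take B).drop (A-1)).prod := by
      rw [getD_set' _ _ _ _ hq1, getD_set' _ _ _ _ hq1, if_neg (by omega : ¬ A - 1 = L),
        if_neg (by omega : ¬ A = L), c4 (A-1) (by omega) (by omega), ← seg_one]
      have e : A - 1 + 1 = A := by omega
      rw [e]
      by_cases h : A < B
      · rw [if_pos h, c6 A le_rfl h, seg_mul _ _ _ _ (by omega) hAB]
      · have : A = B := by omega
        subst this
        simp
    rw [vA, vL]
    rw [vL] at hq2
    have key : ∀ i, (((q.set L ((vals.take B).drop L).prod)).set (A-1)
        ((vals.take B).drop (A-1)).prod).getD i 1 = if i = A - 1 then ((vals.take B).drop (A-1)).prod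
          else if i = L then ((vals.take B).drop L).prod else q.getD i 1 := by
      intro i
      rw [getD_set' _ _ _ _ hq2, getD_set' _ _ _ _ hq1]
    simp only [key, List.length_set]
    refine ⟨hLR', by omega, by omega, hB, ⟨c1, ?_, ?_, ?_, Or.inr c5, ?_, ?_, c8⟩, Or.inr ?_⟩
    · intro i hi
      rw [if_neg (by omega)]
      split_ifs with h
      · rw [h]
      · exact c2 i (by omega)
    · intro i h1 h2
      rw [if_neg (by omega), if_neg (by omega)]
      exact c3 i (by omega) h2
    · intro i h1 h2
      rw [if_neg (by omega), if_neg (by omega)]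
      exact c4 i h1 (by omega)
    · intro i h1 h2
      split_ifs with h h'
      · rw [h]
      · omega
      · exact c6 i (by omega) h2
    · intro i h1 h2
      rw [if_neg (by omega), if_neg (by omega)]
      exact c7 i h1 h2
    · omega

theorem fixup_inv (q vals : List M) (L R A B : ℕ) (x y : M)
    (hLR : L ≤ R) (hRA : R ≤ A) (hAB : A ≤ B) (hB : B ≤ q.length)
    (hc : ContentsInv ⟨q, L, R, A, B, x, y⟩ vals)
    (hs : L + B = q.length) (he : R - L = A - R) (h0 : B ≠ 0) :
    Inv (fixup ⟨q, L, R, A, B, x, y⟩) vals := by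
  by_cases hLB : L = B
  · have h1 : R = B := by omega
    have h2 : A = B := by omega
    subst hLB; subst h1; subst h2
    have hn : q.length ≠ 0 := by omega
    have e : fixup ⟨q, A, A, A, A, x, y⟩ = fixup ⟨q, 0, A, q.length, q.length, y, 1⟩ := by
      simp [fixup, h0, hn, Ne.symm hn]
    rw [e]
    obtain ⟨c1, c2, c3, c4, c5, c6, c7, c8⟩ := hc
    dsimp only at c1 c2 c3 c4 c5 c6 c7 c8
    refine step_inv _ _ _ _ _ _ _ _ (by omega) (by omega) le_rfl le_rfl (by omega) ?_
      (by omega) (by omega) hn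
    refine ⟨c1, ?_, ?_, ?_, Or.inr ?_, ?_, ?_, ?_⟩ <;> dsimp only
    · intro i hi; omega
    · intro i _ hi; exact c2 i hi
    · intro i h1 h2; exact c7 i h1 h2
    · rw [c8, c1, List.take_length]
    · intro i _ _; omega
    · intro i _ _; omega
    · rw [c1, List.drop_length]; rfl
  · exact step_inv _ _ _ _ _ _ _ _ hLR hRA hAB hB (by omega) hc hs he h0

theorem insert_evict_preserve (s : State M) (vals : List M) (h : Inv s vals) :
    (∀ v : M, Inv (insertOp s v) (vals ++ [v])) ∧
    (vals ≠ [] → Inv (evictOp s) vals.tail) := by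
  obtain ⟨q, L, R, A, B, x, y⟩ := s
  obtain ⟨hLR, hRA, hAB, hB, ⟨c1, c2, c3, c4, c5, c6, c7, c8⟩, hs⟩ := h
  dsimp only [SizeInv] at hLR hRA hAB hB c1 c2 c3 c4 c5 c6 c7 c8 hs
  constructor
  · intro v
    by_cases h0 : B = 0
    · have hq : q.length = 0 := by omega
      have hv : vals.length = 0 := by omega
      rw [List.length_eq_zero_iff] at hq hv
      subst hq; subst hv
      simp [insertOp, fixup, h0, Inv, ContentsInv, SizeInv]
      omega
    · have tk : ∀ j, j ≤ vals.length → (vals ++ [v]).take j = vals.take j := fun j hj =>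
        List.take_append_of_le_length hj
      have gq : ∀ i, i < q.length → (q ++ [v]).getD i 1 = q.getD i 1 := fun i hi =>
        List.getD_append _ _ _ _ hi
      have gv : ∀ i, i < vals.length → (vals ++ [v]).getD i 1 = vals.getD i 1 := fun i hi =>
        List.getD_append _ _ _ _ hi
      refine fixup_inv _ _ _ _ _ _ _ _ hLR hRA hAB ?_ ?_ ?_ (by dsimp only; omega) h0
      · simp; omega
      · refine ⟨?_, ?_, ?_, ?_, ?_, ?_, ?_, ?_⟩ <;> dsimp only
        · simp [c1]
        · intro i hi
          rw [gq i (by omega), tk B (by omega)]; exact c2 i hi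
        · intro i h1 h2
          rw [gq i (by omega), tk R (by omega)]; exact c3 i h1 h2
        · intro i h1 h2
          rw [gq i (by omega), gv i (by omega)]; exact c4 i h1 h2
        · rw [tk B (by omega)]; exact c5
        · intro i h1 h2
          rw [gq i (by omega), tk B (by omega)]; exact c6 i h1 h2
        · intro i h1 h2
          by_cases h : i < q.length
          · rw [gq i h, gv i (by omega)]; exact c7 i h1 h
          · have : i = q.length := by simp at h2; omega
            subst this
            rw [List.getD_append_right _ _ _ _ le_rfl, List.getD_append_right _ _ _ _ (by omega), c1]
        · rw [List.drop_append_of_le_length (by omega), c8]; simp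
      · simp; omega
  · intro hne
    cases vals with
    | nil => exact absurd rfl hne
    | cons a t =>
    cases q with
    | nil => simp at c1
    | cons b u =>
    simp only [List.length_cons] at c1 hB hs c7
    obtain ⟨L, rfl⟩ : ∃ k, L = k + 1 := ⟨L - 1, by omega⟩
    obtain ⟨R, rfl⟩ : ∃ k, R = k + 1 := ⟨R - 1, by omega⟩
    obtain ⟨A, rfl⟩ : ∃ k, A = k + 1 := ⟨A - 1, by omega⟩
    obtain ⟨B, rfl⟩ : ∃ k, B = k + 1 := ⟨B - 1, by omega⟩
    simp only [evictOp, List.tail_cons, Nat.add_sub_cancel]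
    by_cases h0 : B = 0
    · have hu : u.length = 0 := by omega
      have ht : t.length = 0 := by omega
      rw [List.length_eq_zero_iff] at hu ht
      subst hu; subst ht
      simp [fixup, h0, Inv, ContentsInv, SizeInv]
    · refine fixup_inv _ _ _ _ _ _ _ _ (by omega) (by omega) (by omega) (by omega) ?_
        (by omega) (by omega) h0
      refine ⟨by dsimp only; omega, ?_, ?_, ?_, ?_, ?_, ?_, ?_⟩ <;> dsimp only
      · intro i hi; simpa using c2 (i+1) (by omega)
      · intro i h1 h2; simpa using c3 (i+1) (by omega) (by omega)
      · intro i h1 h2; simpa using c4 (i+1) (by omega) (by omega)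
      · simpa using c5
      · intro i h1 h2; simpa using c6 (i+1) (by omega) (by omega)
      · intro i h1 h2; simpa using c7 (i+1) (by omega) (by omega)
      · simpa using c8

end DabaLite
end
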